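/- arXiv:2308.14764 — 2 statements merged into one kernel-verified Lean document; each statement's English description precedes it below -/
import Mathlib

section
/- Let n be a positive integer, let c be a real number, and let C_U > 0. There is a constant C_L = C_L(n, c, C_U) > 0 with the following property: for every C² function f : (0,∞) → ℝ with f(t) ≥ 0 for all t > 0 and such that t ↦ t^{−c} f(t) is non-increasing on (0,∞), every x₀ ∈ ℝⁿ, every R > 0, and every positive solution u of Δu + f(u) = 0 on B(x₀, 2R) satisfying the universal bound sup_{B(x₀,2R)} f(u)/u ≤ C_U / R², one has the logarithmic gradient estimate sup_{B(x₀,R)} |∇u|²/u² ≤ C_L / R². -/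
open Set Metric

/-- Euclidean space ℝⁿ. -/
abbrev E (n : ℕ) := EuclideanSpace ℝ (Fin n)

/-- The Laplacian of `u : ℝⁿ → ℝ`: the sum of its second partial derivatives. -/
noncomputable def lap {n : ℕ} (u : E n → ℝ) (x : E n) : ℝ :=
  ∑ i : Fin n,
    iteratedFDeriv ℝ 2 u x ![EuclideanSpace.single i 1, EuclideanSpace.single i 1]

open MeasureTheory

theorem hasDerivAt_max_zero_pow (k : ℕ) (t : ℝ) :
    HasDerivAt (fun s : ℝ => (max 0 s) ^ (k + 2)) ((k + 2 : ℕ) * (max 0 t) ^ (k + 1)) t := by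
  rcases lt_trichotomy t 0 with h | rfl | h
  · have h0 : max 0 t = 0 := max_eq_left h.le
    rw [h0, zero_pow (Nat.succ_ne_zero k), mul_zero]
    refine (hasDerivAt_const t (0 : ℝ)).congr_of_eventuallyEq ?_
    filter_upwards [Iio_mem_nhds h] with s hs
    rw [max_eq_left (mem_Iio.1 hs).le, zero_pow (Nat.succ_ne_zero _)]
  · rw [max_self, zero_pow (Nat.succ_ne_zero k), mul_zero, hasDerivAt_iff_isLittleO_nhds_zero]
    have hO : (fun s : ℝ => (max 0 s) ^ (k + 2)) =O[nhds 0] fun s : ℝ => s ^ (k + 2) :=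
      Asymptotics.IsBigO.of_bound 1 (Filter.Eventually.of_forall fun s => by
        rw [norm_pow, norm_pow, one_mul, Real.norm_eq_abs, Real.norm_eq_abs]
        refine pow_le_pow_left₀ (abs_nonneg _) ?_ _
        rw [abs_of_nonneg (le_max_left 0 s)]
        exact max_le (abs_nonneg s) (le_abs_self s))
    have ho : (fun s : ℝ => s ^ (k + 2)) =o[nhds 0] fun s : ℝ => s := by
      simpa using Asymptotics.isLittleO_pow_pow (𝕜 := ℝ) (show 1 < k + 2 by omega)
    simpa using hO.trans_isLittleO ho
  · have h0 : max 0 t = t := max_eq_right h.le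
    rw [h0]
    refine (hasDerivAt_pow (k + 2) t).congr_of_eventuallyEq ?_
    filter_upwards [Ioi_mem_nhds h] with s hs
    rw [max_eq_right (mem_Ioi.1 hs).le]

section Weights

variable {F : Type*} [NormedAddCommGroup F]

/-- The truncated polynomial weight `(1 - |y|²)₊ᵏ`, supported in the closed unit ball. -/
noncomputable def ballWeight (k : ℕ) (y : F) : ℝ := (max 0 (1 - ‖y‖ ^ 2)) ^ k

theorem ballWeight_nonneg (k : ℕ) (y : F) : 0 ≤ ballWeight k y :=
  pow_nonneg (le_max_left _ _) _

theorem continuous_ballWeight (k : ℕ) : Continuous (ballWeight k : F → ℝ) := by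
  unfold ballWeight; fun_prop

theorem ballWeight_eq_zero (k : ℕ) {y : F} (hy : y ∉ closedBall (0 : F) 1) :
    ballWeight (k + 1) y = 0 := by
  have h : 1 < ‖y‖ := by simpa using hy
  rw [ballWeight, max_eq_left (by nlinarith), zero_pow (Nat.succ_ne_zero k)]

variable [InnerProductSpace ℝ F]

theorem hasCompactSupport_ballWeight [FiniteDimensional ℝ F] (k : ℕ) :
    HasCompactSupport (ballWeight (k + 1) : F → ℝ) :=
  HasCompactSupport.intro (isCompact_closedBall 0 1) fun _ hy => ballWeight_eq_zero k hy

theorem hasFDerivAt_ballWeight (k : ℕ) (y : F) :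
    HasFDerivAt (ballWeight (k + 2) : F → ℝ)
      ((-(2 * (k + 2 : ℕ)) * ballWeight (k + 1) y) • innerSL ℝ y) y := by
  have h1 : HasFDerivAt (fun z : F => 1 - ‖z‖ ^ 2) (-(2 • innerSL ℝ y)) y :=
    (hasStrictFDerivAt_norm_sq y).hasFDerivAt.const_sub 1
  have h2 := (hasDerivAt_max_zero_pow k (1 - ‖y‖ ^ 2)).comp_hasFDerivAt y h1
  refine h2.congr_fderiv ?_
  ext z
  simp [ballWeight]
  ring

theorem fderiv_ballWeight_apply (k : ℕ) (y a : F) :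
    fderiv ℝ (ballWeight (k + 2)) y a =
      -(2 * (k + 2 : ℕ)) * (inner ℝ y a * ballWeight (k + 1) y) := by
  rw [(hasFDerivAt_ballWeight k y).fderiv]
  simp
  ring

theorem contDiff_ballWeight (k : ℕ) : ContDiff ℝ 1 (ballWeight (k + 2) : F → ℝ) := by
  rw [contDiff_one_iff_fderiv]
  refine ⟨fun y => (hasFDerivAt_ballWeight k y).differentiableAt, ?_⟩
  rw [funext fun y : F => (hasFDerivAt_ballWeight k y).fderiv]
  have := continuous_ballWeight (F := F) (k + 1)
  fun_prop

theorem fderiv_inner_mul_ballWeight_apply (k : ℕ) (a b y : F) :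
    fderiv ℝ (fun z => inner ℝ a z * ballWeight (k + 2) z) y b =
      inner ℝ a b * ballWeight (k + 2) y
        - 2 * (k + 2 : ℕ) * (inner ℝ y a * inner ℝ y b * ballWeight (k + 1) y) := by
  have h1 : HasFDerivAt (fun z : F => inner ℝ a z) (innerSL ℝ a) y := (innerSL ℝ a).hasFDerivAt
  rw [(h1.fun_mul (hasFDerivAt_ballWeight k y)).fderiv]
  simp [real_inner_comm a y]
  ring

theorem add_smul_mem_closedBall {x y : F} {r : ℝ} (hr : 0 ≤ r) (hy : y ∈ closedBall (0 : F) 1) :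
    x + r • y ∈ closedBall x r := by
  have : ‖y‖ ≤ 1 := by simpa using hy
  rw [mem_closedBall, dist_self_add_left, norm_smul, Real.norm_of_nonneg hr]
  exact mul_le_of_le_one_right hr this

end Weights

section SecondDerivatives

variable {F : Type*} [NormedAddCommGroup F] [NormedSpace ℝ F]

theorem contDiff_fderiv_apply {v : F → ℝ} (hv : ContDiff ℝ 2 v) (e : F) :
    ContDiff ℝ 1 fun z => fderiv ℝ v z e :=
  (hv.fderiv_right (m := 1) (by norm_num)).clm_apply contDiff_const

theorem continuous_fderiv_fderiv_apply {v : F → ℝ} (hv : ContDiff ℝ 2 v) (a b : F) :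
    Continuous fun z => fderiv ℝ (fun w => fderiv ℝ v w a) z b :=
  ((contDiff_fderiv_apply hv a).continuous_fderiv one_ne_zero).clm_apply continuous_const

theorem fderiv_fderiv_apply_eq {v : F → ℝ} {z : F} (hv : ContDiffAt ℝ 2 v z) (a b : F) :
    fderiv ℝ (fun w => fderiv ℝ v w a) z b = fderiv ℝ (fderiv ℝ v) z b a := by
  have h : DifferentiableAt ℝ (fderiv ℝ v) z :=
    (hv.fderiv_right (m := 1) (by norm_num)).differentiableAt one_ne_zero
  rw [fderiv_clm_apply h (differentiableAt_const a)]
  simp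

theorem fderiv_fderiv_apply_comm {v : F → ℝ} (hv : ContDiff ℝ 2 v) (a b z : F) :
    fderiv ℝ (fun w => fderiv ℝ v w a) z b = fderiv ℝ (fun w => fderiv ℝ v w b) z a := by
  rw [fderiv_fderiv_apply_eq hv.contDiffAt, fderiv_fderiv_apply_eq hv.contDiffAt]
  exact hv.contDiffAt.isSymmSndFDerivAt (by simp) b a

end SecondDerivatives

section WeightedMeans

variable {F : Type*} [NormedAddCommGroup F] [InnerProductSpace ℝ F] [FiniteDimensional ℝ F]
  [MeasurableSpace F] [BorelSpace F]

/-- The integral of `ψ` against the dilation of `v` by `r` about `x`. -/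
noncomputable def dilatedIntegral (v ψ : F → ℝ) (x : F) (r : ℝ) : ℝ :=
  ∫ y, v (x + r • y) * ψ y

theorem integrable_dilated {v ψ : F → ℝ} (hv : Continuous v) (hψ : Continuous ψ)
    (hψc : HasCompactSupport ψ) (x : F) (r : ℝ) :
    Integrable fun y => v (x + r • y) * ψ y :=
  Continuous.integrable_of_hasCompactSupport (by fun_prop) hψc.mul_left

theorem integral_dilated_mul_fderiv {v ψ : F → ℝ} (hv : ContDiff ℝ 1 v) (hψ : ContDiff ℝ 1 ψ)
    (hψc : HasCompactSupport ψ) (x e : F) (r : ℝ) :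
    dilatedIntegral v (fun y => fderiv ℝ ψ y e) x r =
      -(r * dilatedIntegral (fun z => fderiv ℝ v z e) ψ x r) := by
  have hd : ∀ y, HasFDerivAt (fun y => v (x + r • y))
      ((fderiv ℝ v (x + r • y)).comp (r • ContinuousLinearMap.id ℝ F)) y := fun y =>
    HasFDerivAt.comp y (hv.differentiable one_ne_zero _).hasFDerivAt
      (((hasFDerivAt_id y).const_smul r).const_add x)
  have hde : ∀ y, fderiv ℝ (fun y => v (x + r • y)) y e = r * fderiv ℝ v (x + r • y) e := by
    intro y; rw [(hd y).fderiv]; simp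
  have hve : Continuous fun z => fderiv ℝ v z e :=
    (hv.continuous_fderiv one_ne_zero).clm_apply continuous_const
  have hψe : Continuous fun z => fderiv ℝ ψ z e :=
    (hψ.continuous_fderiv one_ne_zero).clm_apply continuous_const
  have key := integral_mul_fderiv_eq_neg_fderiv_mul_of_integrable (μ := (volume : Measure F))
    (f := fun y => v (x + r • y)) (g := ψ) (v := e)
    (by simp_rw [hde, mul_assoc]
        exact (integrable_dilated hve hψ.continuous hψc x r).const_mul r)
    (integrable_dilated hv.continuous hψe (hψc.fderiv_apply ℝ e) x r)
    (integrable_dilated hv.continuous hψ.continuous hψc x r)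
    (fun y _ => (hd y).differentiableAt) (fun y _ => hψ.differentiable one_ne_zero y)
  simp_rw [hde, mul_assoc] at key
  rw [dilatedIntegral, key, integral_const_mul, dilatedIntegral]

theorem hasDerivAt_dilatedIntegral {v ψ : F → ℝ} (hv : ContDiff ℝ 1 v)
    (hvc : HasCompactSupport v) (hψ : Continuous ψ) (hψc : HasCompactSupport ψ)
    {ι : Type*} [Fintype ι] (b : OrthonormalBasis ι ℝ F) (x : F) (r : ℝ) :
    HasDerivAt (dilatedIntegral v ψ x)
      (∑ i, dilatedIntegral (fun z => fderiv ℝ v z (b i)) (fun y => inner ℝ (b i) y * ψ y) x r)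
      r := by
  have hv' : Continuous (fderiv ℝ v) := hv.continuous_fderiv one_ne_zero
  obtain ⟨M, hM⟩ := hv'.bounded_above_of_compact_support (hvc.fderiv ℝ)
  have hmeas : ∀ s : ℝ, Integrable fun y => v (x + s • y) * ψ y :=
    integrable_dilated hv.continuous hψ hψc x
  have main := hasDerivAt_integral_of_dominated_loc_of_deriv_le (μ := (volume : Measure F))
    (F := fun s y => v (x + s • y) * ψ y)
    (F' := fun s y => fderiv ℝ v (x + s • y) y * ψ y)
    (bound := fun y => M * (‖y‖ * ‖ψ y‖)) (x₀ := r) (s := univ) Filter.univ_mem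
    (Filter.Eventually.of_forall fun s => (hmeas s).aestronglyMeasurable) (hmeas r)
    (by
      refine Continuous.aestronglyMeasurable ?_
      exact ((hv'.comp (by fun_prop)).clm_apply continuous_id).mul hψ)
    (Filter.Eventually.of_forall fun y s _ => by
      rw [norm_mul, ← mul_assoc]
      gcongr
      exact (ContinuousLinearMap.le_opNorm _ _).trans (by gcongr; exact hM _))
    ((Continuous.integrable_of_hasCompactSupport (by fun_prop) hψc.norm.mul_left).const_mul M)
    (Filter.Eventually.of_forall fun y s _ => by
      have h1 : HasDerivAt (fun s : ℝ => x + s • y) y s := by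
        simpa using ((hasDerivAt_id s).smul_const y).const_add x
      exact ((hv.differentiable one_ne_zero _).hasFDerivAt.comp_hasDerivAt s h1).mul_const _)
  refine main.2.congr_deriv ?_
  simp only [dilatedIntegral]
  rw [← integral_finsetSum]
  · refine integral_congr_ae (Filter.Eventually.of_forall fun y => ?_)
    have hy : fderiv ℝ v (x + r • y) y
        = ∑ i, inner ℝ (b i) y * fderiv ℝ v (x + r • y) (b i) := by
      conv_lhs => enter [2]; rw [← b.sum_repr' y]
      simp
    simp only [hy, Finset.sum_mul]
    exact Finset.sum_congr rfl fun i _ => by ring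
  · intro i _
    exact integrable_dilated (v := fun z => fderiv ℝ v z (b i)) (hv'.clm_apply continuous_const)
      (by fun_prop) hψc.mul_left x r

theorem dilatedIntegral_zero (v ψ : F → ℝ) (x : F) :
    dilatedIntegral v ψ x 0 = v x * ∫ y, ψ y := by
  simp [dilatedIntegral, integral_const_mul]

theorem dilatedIntegral_const_mul_right (v ψ : F → ℝ) (c : ℝ) (x : F) (r : ℝ) :
    dilatedIntegral v (fun y => c * ψ y) x r = c * dilatedIntegral v ψ x r := by
  simp only [dilatedIntegral, mul_left_comm _ c, integral_const_mul]

theorem dilatedIntegral_fderiv_mul_ballWeight {v : F → ℝ} (hv : ContDiff ℝ 1 v) (k : ℕ)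
    (x e : F) (r : ℝ) :
    r * dilatedIntegral (fun z => fderiv ℝ v z e) (ballWeight (k + 2)) x r =
      2 * (k + 2 : ℕ) *
        dilatedIntegral v (fun y => inner ℝ e y * ballWeight (k + 1) y) x r := by
  have h := integral_dilated_mul_fderiv hv (contDiff_ballWeight k)
    (hasCompactSupport_ballWeight (k + 1)) x e r
  simp_rw [fderiv_ballWeight_apply, dilatedIntegral_const_mul_right, real_inner_comm e] at h
  linarith

theorem dilatedIntegral_fderiv_inner_swap {v : F → ℝ} (hv : ContDiff ℝ 1 v) (k : ℕ)
    (x a b : F) {r : ℝ} (hr : r ≠ 0) :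
    dilatedIntegral (fun z => fderiv ℝ v z a) (fun y => inner ℝ b y * ballWeight (k + 2) y) x r =
      dilatedIntegral (fun z => fderiv ℝ v z b)
        (fun y => inner ℝ a y * ballWeight (k + 2) y) x r := by
  have hc : ∀ c : F, ContDiff ℝ 1 fun y => inner ℝ c y * ballWeight (k + 2) y := fun c =>
    (innerSL ℝ c).contDiff.mul (contDiff_ballWeight k)
  have hs : ∀ c : F, HasCompactSupport fun y => inner ℝ c y * ballWeight (k + 2) y := fun c =>
    (hasCompactSupport_ballWeight (k + 1)).mul_left
  have h1 := integral_dilated_mul_fderiv hv (hc b) (hs b) x a r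
  have h2 := integral_dilated_mul_fderiv hv (hc a) (hs a) x b r
  simp_rw [fderiv_inner_mul_ballWeight_apply] at h1 h2
  rw [real_inner_comm] at h1
  simp_rw [mul_comm (inner ℝ _ b) (inner ℝ _ a)] at h1
  exact mul_left_cancel₀ hr (by linarith)

theorem integral_ballWeight_pos (k : ℕ) : 0 < ∫ y : F, ballWeight (k + 1) y :=
  (continuous_ballWeight (k + 1)).integral_pos_of_hasCompactSupport_nonneg_nonzero
    (hasCompactSupport_ballWeight k) (ballWeight_nonneg (k + 1)) (x := 0) (by simp [ballWeight])

theorem dilatedIntegral_ballWeight_nonpos {w : F → ℝ} (k : ℕ) {x : F} {r : ℝ} (hr : 0 ≤ r)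
    (h : ∀ z ∈ closedBall x r, w z ≤ 0) :
    dilatedIntegral w (ballWeight (k + 1)) x r ≤ 0 := by
  refine integral_nonpos fun y => ?_
  by_cases hy : y ∈ closedBall (0 : F) 1
  · exact mul_nonpos_of_nonpos_of_nonneg (h _ (add_smul_mem_closedBall hr hy))
      (ballWeight_nonneg _ _)
  · simp [ballWeight_eq_zero k hy]

theorem abs_dilatedIntegral_inner_mul_ballWeight_le {w W : F → ℝ} (hW : Continuous W) (k : ℕ)
    (x e : F) {r : ℝ} (hr : 0 ≤ r) (h : ∀ z ∈ closedBall x r, |w z| ≤ W z) :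
    |dilatedIntegral w (fun y => inner ℝ e y * ballWeight (k + 1) y) x r| ≤
      ‖e‖ * dilatedIntegral W (ballWeight (k + 1)) x r := by
  rw [dilatedIntegral, dilatedIntegral, ← integral_const_mul, ← Real.norm_eq_abs]
  refine norm_integral_le_of_norm_le ((integrable_dilated hW (continuous_ballWeight (k + 1))
    (hasCompactSupport_ballWeight k) x r).const_mul ‖e‖) (Filter.Eventually.of_forall fun y => ?_)
  by_cases hy : y ∈ closedBall (0 : F) 1
  · have h1 := h _ (add_smul_mem_closedBall hr hy)
    have h2 : |inner ℝ e y| ≤ ‖e‖ :=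
      (abs_real_inner_le_norm e y).trans
        (mul_le_of_le_one_right (norm_nonneg e) (by simpa using hy))
    have h3 := ballWeight_nonneg (k + 1) y
    rw [Real.norm_eq_abs, abs_mul, abs_mul, abs_of_nonneg h3]
    calc |w (x + r • y)| * (|inner ℝ e y| * ballWeight (k + 1) y)
        ≤ W (x + r • y) * (‖e‖ * ballWeight (k + 1) y) :=
          mul_le_mul h1 (by gcongr) (by positivity) ((abs_nonneg _).trans h1)
      _ = ‖e‖ * (W (x + r • y) * ballWeight (k + 1) y) := by ring
  · simp [ballWeight_eq_zero k hy]

theorem sum_dilatedIntegral {ι : Type*} [Fintype ι] {w : ι → F → ℝ} {ψ : F → ℝ}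
    (hw : ∀ i, Continuous (w i)) (hψ : Continuous ψ) (hψc : HasCompactSupport ψ) (x : F) (r : ℝ) :
    ∑ i, dilatedIntegral (w i) ψ x r = dilatedIntegral (fun z => ∑ i, w i z) ψ x r := by
  simp only [dilatedIntegral, Finset.sum_mul]
  exact (integral_finsetSum _ fun i _ => integrable_dilated (hw i) hψ hψc x r).symm

variable {ι : Type*} [Fintype ι]

/-- The sum of the second derivatives of `v` along an orthonormal basis. -/
noncomputable def basisLaplacian (b : OrthonormalBasis ι ℝ F) (v : F → ℝ) (z : F) : ℝ :=
  ∑ i, fderiv ℝ (fun w => fderiv ℝ v w (b i)) z (b i)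

/-- Weighted mean value inequality for superharmonic functions. -/
theorem dilatedIntegral_ballWeight_le {v : F → ℝ} (hv : ContDiff ℝ 2 v)
    (hvc : HasCompactSupport v) (b : OrthonormalBasis ι ℝ F) (k : ℕ) (x : F) {r : ℝ} (hr : 0 ≤ r)
    (hlap : ∀ z ∈ closedBall x r, basisLaplacian b v z ≤ 0) :
    dilatedIntegral v (ballWeight (k + 1)) x r ≤ v x * ∫ y : F, ballWeight (k + 1) y := by
  have hd := hasDerivAt_dilatedIntegral (hv.of_le one_le_two) hvc (continuous_ballWeight (k + 1))
    (hasCompactSupport_ballWeight k) b x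
  have hanti : AntitoneOn (dilatedIntegral v (ballWeight (k + 1)) x) (Icc 0 r) := by
    refine antitoneOn_of_deriv_nonpos (convex_Icc 0 r)
      (fun s _ => (hd s).continuousAt.continuousWithinAt)
      (fun s _ => (hd s).differentiableAt.differentiableWithinAt) fun s hs => ?_
    rw [interior_Icc] at hs
    rw [(hd s).deriv]
    have h := dilatedIntegral_ballWeight_nonpos (w := basisLaplacian b v) (k + 1) hs.1.le
      fun z hz => hlap z (closedBall_subset_closedBall hs.2.le hz)
    have hsum := sum_dilatedIntegral
      (fun i => continuous_fderiv_fderiv_apply hv (b i) (b i))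
      (continuous_ballWeight (k + 2)) (hasCompactSupport_ballWeight (k + 1)) x s
    have hparts := fun i => dilatedIntegral_fderiv_mul_ballWeight
      (contDiff_fderiv_apply hv (b i)) k x (b i) s
    have htot : s * dilatedIntegral (basisLaplacian b v) (ballWeight (k + 2)) x s =
        2 * (k + 2 : ℕ) * ∑ i, dilatedIntegral (fun z => fderiv ℝ v z (b i))
          (fun y => inner ℝ (b i) y * ballWeight (k + 1) y) x s := by
      rw [Finset.mul_sum, ← Finset.sum_congr rfl fun i _ => hparts i, ← Finset.mul_sum, hsum]
      rfl
    have hneg := mul_nonpos_of_nonneg_of_nonpos hs.1.le h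
    rw [htot] at hneg
    exact nonpos_of_mul_nonpos_right hneg (by positivity)
  have h := hanti (left_mem_Icc.2 hr) (right_mem_Icc.2 hr) hr
  rwa [dilatedIntegral_zero] at h

/-- Pointwise gradient bound for nonnegative functions satisfying `-K v ≤ Δv ≤ 0` on a ball. -/
theorem abs_fderiv_apply_le {v : F → ℝ} (hv : ContDiff ℝ 2 v) (hvc : HasCompactSupport v)
    (b : OrthonormalBasis ι ℝ F) (x : F) {K ρ : ℝ} (hK : 0 ≤ K) (hρ : 0 < ρ)
    (hv0 : ∀ z ∈ closedBall x ρ, 0 ≤ v z)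
    (hsup : ∀ z ∈ closedBall x ρ, basisLaplacian b v z ≤ 0)
    (hsub : ∀ z ∈ closedBall x ρ, -(K * v z) ≤ basisLaplacian b v z) (e : F) :
    |fderiv ℝ v x e| ≤ v x *
      (K * ρ + 6 * ((∫ y : F, ballWeight 2 y) / ∫ y : F, ballWeight 3 y) / ρ) * ‖e‖ := by
  have hP : 0 < ∫ y : F, ballWeight 3 y := integral_ballWeight_pos 2
  have hd := hasDerivAt_dilatedIntegral (contDiff_fderiv_apply hv e) (hvc.fderiv_apply ℝ e)
    (continuous_ballWeight 3) (hasCompactSupport_ballWeight 2) b x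
  obtain ⟨s, hs, hslope⟩ := exists_hasDerivAt_eq_slope _ _ hρ
    (fun t _ => (hd t).continuousAt.continuousWithinAt) fun t _ => hd t
  have hmean : ∀ k, ∀ t ∈ Icc 0 ρ,
      dilatedIntegral v (ballWeight (k + 1)) x t ≤ v x * ∫ y : F, ballWeight (k + 1) y :=
    fun k t ht => dilatedIntegral_ballWeight_le hv hvc b k x ht.1
      fun z hz => hsup z (closedBall_subset_closedBall ht.2 hz)
  have hswap : ∀ i, dilatedIntegral
      (fun z => fderiv ℝ (fun w => fderiv ℝ v w e) z (b i))
      (fun y => inner ℝ (b i) y * ballWeight 3 y) x s =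
      dilatedIntegral (fun z => fderiv ℝ (fun w => fderiv ℝ v w (b i)) z (b i))
        (fun y => inner ℝ e y * ballWeight 3 y) x s := fun i => by
    simp_rw [fderiv_fderiv_apply_comm hv e (b i)]
    exact dilatedIntegral_fderiv_inner_swap (contDiff_fderiv_apply hv (b i)) 1 x e (b i) hs.1.ne'
  have hslope_le : |∑ i, dilatedIntegral
      (fun z => fderiv ℝ (fun w => fderiv ℝ v w e) z (b i))
      (fun y => inner ℝ (b i) y * ballWeight 3 y) x s| ≤
      ‖e‖ * (K * (v x * ∫ y : F, ballWeight 3 y)) := by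
    have hc := continuous_ballWeight (F := F) 3
    rw [Finset.sum_congr rfl fun i _ => hswap i,
      sum_dilatedIntegral (fun i => continuous_fderiv_fderiv_apply hv (b i) (b i))
        (ψ := fun y => inner ℝ e y * ballWeight 3 y) (by fun_prop)
        (hasCompactSupport_ballWeight 2).mul_left]
    refine (abs_dilatedIntegral_inner_mul_ballWeight_le (W := fun z => K * v z)
      (continuous_const.mul hv.continuous) 2 x e hs.1.le fun z hz => ?_).trans ?_
    · have hz' := closedBall_subset_closedBall hs.2.le hz
      have h1 := hsup z hz'
      have h2 := hsub z hz'
      exact abs_le.2 ⟨h2, h1.trans (mul_nonneg hK (hv0 z hz'))⟩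
    · have h1 : dilatedIntegral (fun z => K * v z) (ballWeight 3) x s =
          K * dilatedIntegral v (ballWeight 3) x s := by
        simp only [dilatedIntegral, mul_assoc, integral_const_mul]
      rw [h1]
      gcongr
      exact hmean 2 s ⟨hs.1.le, hs.2.le⟩
  have hend : |dilatedIntegral (fun z => fderiv ℝ v z e) (ballWeight 3) x ρ| ≤
      6 * (‖e‖ * (v x * ∫ y : F, ballWeight 2 y)) / ρ := by
    have h1 := dilatedIntegral_fderiv_mul_ballWeight (hv.of_le one_le_two) 1 x e ρ
    have h2 := abs_dilatedIntegral_inner_mul_ballWeight_le hv.continuous 1 x e hρ.le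
      fun z hz => (abs_of_nonneg (hv0 z hz)).le
    have h3 := mul_le_mul_of_nonneg_left (hmean 1 ρ ⟨hρ.le, le_rfl⟩) (norm_nonneg e)
    rw [le_div_iff₀ hρ, ← abs_of_pos hρ, ← abs_mul, abs_of_pos hρ, mul_comm, h1, abs_mul]
    norm_num at h2 h3 ⊢
    linarith
  rw [dilatedIntegral_zero, sub_zero, eq_div_iff hρ.ne'] at hslope
  set D := ∑ i, dilatedIntegral (fun z => fderiv ℝ (fun w => fderiv ℝ v w e) z (b i))
      (fun y => inner ℝ (b i) y * ballWeight 3 y) x s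
  set P := ∫ y : F, ballWeight 3 y
  set Q := ∫ y : F, ballWeight 2 y
  set G := dilatedIntegral (fun z => fderiv ℝ v z e) (ballWeight 3) x ρ
  have hfd : fderiv ℝ v x e * P = G - D * ρ := by linarith
  have habs : |fderiv ℝ v x e| * P ≤ |G| + |D| * ρ := by
    have h := abs_sub G (D * ρ)
    rwa [← hfd, abs_mul, abs_of_pos hP, abs_mul, abs_of_pos hρ] at h
  refine le_of_mul_le_mul_right (habs.trans ?_) hP
  calc |G| + |D| * ρ ≤ 6 * (‖e‖ * (v x * Q)) / ρ + ‖e‖ * (K * (v x * P)) * ρ := by gcongr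
    _ = _ := by field_simp; ring

end WeightedMeans

theorem lap_eq_basisLaplacian {n : ℕ} {u : E n → ℝ} {x : E n} (hu : ContDiffAt ℝ 2 u x) :
    lap u x = basisLaplacian (EuclideanSpace.basisFun (Fin n) ℝ) u x := by
  simp only [lap, basisLaplacian, iteratedFDeriv_two_apply, fderiv_fderiv_apply_eq hu]
  simp

/-- A `C²` function on a ball agrees on each smaller ball with a compactly supported `C²`
function. -/
theorem exists_contDiff_hasCompactSupport_eqOn {n : ℕ} {u : E n → ℝ} {x : E n} {r R : ℝ}
    (hr : 0 < r) (hrR : r < R) (hu : ContDiffOn ℝ 2 u (ball x R)) :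
    ∃ v : E n → ℝ, ContDiff ℝ 2 v ∧ HasCompactSupport v ∧ EqOn v u (ball x r) := by
  let χ : ContDiffBump x := ⟨r, (r + R) / 2, hr, by linarith⟩
  have hsupp : tsupport (fun z => χ z * u z) ⊆ closedBall x ((r + R) / 2) :=
    (tsupport_mul_subset_left (f := χ) (g := u)).trans χ.tsupport_eq.subset
  refine ⟨fun z => χ z * u z, contDiff_iff_contDiffAt.2 fun z => ?_, χ.hasCompactSupport.mul_right,
    fun z hz => ?_⟩
  · by_cases hz : z ∈ tsupport fun z => χ z * u z
    · have hz' : z ∈ ball x R := closedBall_subset_ball (by linarith) (hsupp hz)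
      exact χ.contDiffAt.mul (hu.contDiffAt (isOpen_ball.mem_nhds hz'))
    · exact contDiffAt_const.congr_of_eventuallyEq (notMem_tsupport_iff_eventuallyEq.1 hz)
  · simp [χ.one_of_mem_closedBall (ball_subset_closedBall hz)]

/-- the universal boundedness estimate implies the logarithmic gradient
estimate, for nonnegative `f` with `t ↦ t^{-c} f(t)` non-increasing on `(0,∞)`. -/
theorem stmt8 (n : ℕ) (hn : 0 < n) (c C_U : ℝ) (hCU : 0 < C_U) :
    ∃ C_L : ℝ, 0 < C_L ∧
      ∀ f : ℝ → ℝ, ContDiffOn ℝ 2 f (Ioi 0) →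
        (∀ t : ℝ, 0 < t → 0 ≤ f t) →
        (∀ s t : ℝ, 0 < s → s ≤ t → t ^ (-c) * f t ≤ s ^ (-c) * f s) →
        ∀ (x₀ : E n) (R : ℝ), 0 < R →
          ∀ u : E n → ℝ, ContDiffOn ℝ 2 u (ball x₀ (2 * R)) →
            (∀ x ∈ ball x₀ (2 * R), 0 < u x) →
            (∀ x ∈ ball x₀ (2 * R), lap u x + f (u x) = 0) →
            (∀ x ∈ ball x₀ (2 * R), f (u x) / u x ≤ C_U / R ^ 2) →
            ∀ x ∈ ball x₀ R, ‖gradient u x‖ ^ 2 / (u x) ^ 2 ≤ C_L / R ^ 2 := by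
  have hP : 0 < ∫ y : E n, ballWeight 3 y := integral_ballWeight_pos 2
  have hQ : 0 < ∫ y : E n, ballWeight 2 y := integral_ballWeight_pos 1
  set A := (∫ y : E n, ballWeight 2 y) / ∫ y : E n, ballWeight 3 y with hA
  have hA0 : 0 < A := div_pos hQ hP
  refine ⟨(C_U / 2 + 12 * A) ^ 2, by positivity, ?_⟩
  intro f _ hf0 _ x₀ R hR u hu hpos hsol hbd x hx
  have hball : ball x R ⊆ ball x₀ (2 * R) := ball_subset_ball' (by
    have := mem_ball.1 hx; linarith)
  obtain ⟨v, hv, hvc, hvu⟩ := exists_contDiff_hasCompactSupport_eqOn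
    (x := x) (r := 3 / 4 * R) (R := R) (by positivity) (by linarith) (hu.mono hball)
  have hsmall : closedBall x (R / 2) ⊆ ball x (3 / 4 * R) := closedBall_subset_ball (by linarith)
  have hbig : closedBall x (R / 2) ⊆ ball x₀ (2 * R) :=
    hsmall.trans ((ball_subset_ball (by linarith)).trans hball)
  have hev : ∀ z ∈ closedBall x (R / 2), v =ᶠ[nhds z] u := fun z hz =>
    hvu.eventuallyEq_of_mem (isOpen_ball.mem_nhds (hsmall hz))
  have hlap : ∀ z ∈ closedBall x (R / 2),
      basisLaplacian (EuclideanSpace.basisFun (Fin n) ℝ) v z = -f (u z) := fun z hz => by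
    have h1 : lap v z = lap u z := by
      simp only [lap, ((hev z hz).iteratedFDeriv ℝ 2).eq_of_nhds]
    rw [← lap_eq_basisLaplacian hv.contDiffAt, h1]
    linarith [hsol z (hbig hz)]
  have hx' : x ∈ closedBall x (R / 2) := mem_closedBall_self (by positivity)
  have hux : 0 < u x := hpos x (hbig hx')
  have hgrad : ‖gradient u x‖ ≤ u x * ((C_U / 2 + 12 * A) / R) := by
    have h1 : ‖gradient u x‖ = ‖fderiv ℝ v x‖ := by
      rw [(hev x hx').fderiv_eq, ← toDual_gradient, LinearIsometryEquiv.norm_map]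
    rw [h1]
    refine ContinuousLinearMap.opNorm_le_bound _ (by positivity) fun e => ?_
    have h := abs_fderiv_apply_le hv hvc (EuclideanSpace.basisFun (Fin n) ℝ) x
      (K := C_U / R ^ 2) (ρ := R / 2) (by positivity) (by positivity)
      (fun z hz => by rw [(hev z hz).eq_of_nhds]; exact (hpos z (hbig hz)).le)
      (fun z hz => by rw [hlap z hz]; exact neg_nonpos.2 (hf0 _ (hpos z (hbig hz))))
      (fun z hz => by
        rw [hlap z hz, (hev z hz).eq_of_nhds]
        exact neg_le_neg ((div_le_iff₀ (hpos z (hbig hz))).1 (hbd z (hbig hz)))) e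
    rw [(hev x hx').eq_of_nhds, ← hA] at h
    refine h.trans_eq ?_
    field_simp
    ring
  rw [← div_pow, ← div_pow]
  refine pow_le_pow_left₀ (by positivity) ?_ 2
  rwa [div_le_iff₀ hux, mul_comm]
end

section
/- Let n be a positive integer and let Λ₀ < p_S(n) be a real number. There exist β = β(n, Λ₀) > 0 and C = C(n, Λ₀) > 0 with the following property: for every C² function f : (0,∞) → ℝ with f(t) > 0 for all t > 0, sup_{t>0} t f'(t)/f(t) ≤ Λ₀, and t ↦ t f'(t)/f(t) non-decreasing on (0,∞), every x₀ ∈ ℝⁿ, every R > 0, every C_H ≥ 1, and every positive solution u of Δu + f(u) = 0 on B(x₀, 2R) satisfying the Harnack inequality sup_{B(x₀,2R)} u ≤ C_H · inf_{B(x₀,2R)} u, one has sup_{B(x₀,R)} ( |∇u|²/u² + f(u)/u ) ≤ C · C_H^β / R². -/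
open Set Metric

open Filter Topology

lemma second_derivative_test {φ φ' : ℝ → ℝ} {b : ℝ}
    (h : ∀ᶠ s in 𝓝 0, HasDerivAt φ (φ' s) s) (h' : HasDerivAt φ' b 0)
    (hm : IsLocalMin φ 0) : φ' 0 = 0 ∧ 0 ≤ b := by
  have h0 : φ' 0 = 0 := hm.hasDerivAt_eq_zero h.self_of_nhds
  refine ⟨h0, ?_⟩
  by_contra! hb
  have hd : deriv φ =ᶠ[𝓝 0] φ' := h.mono fun s hs => hs.deriv
  have hdd : deriv (deriv φ) 0 = b := by rw [hd.deriv_eq]; exact h'.deriv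
  have hM : IsLocalMax φ 0 :=
    isLocalMax_of_deriv_deriv_neg (by rw [hdd]; exact hb)
      (by rw [hd.self_of_nhds]; exact h0) h.self_of_nhds.continuousAt
  have hc : φ =ᶠ[𝓝 0] fun _ => φ 0 := by
    filter_upwards [hm, hM] with s h1 h2 using le_antisymm h2 h1
  have : deriv (deriv φ) 0 = 0 := by
    rw [hc.deriv.deriv_eq]; simp
  linarith

/-- The second derivative of `u` at `y` in the direction `e`. -/
noncomputable def dirDeriv2 {n : ℕ} (u : E n → ℝ) (y e : E n) : ℝ :=
  fderiv ℝ (fderiv ℝ u) y e e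

lemma dirDeriv2_neg {n : ℕ} (u : E n → ℝ) (y e : E n) :
    dirDeriv2 u y (-e) = dirDeriv2 u y e := by
  simp [dirDeriv2]

lemma lap_eq_sum_dirDeriv2 {n : ℕ} (u : E n → ℝ) (y : E n) :
    lap u y = ∑ i, dirDeriv2 u y (EuclideanSpace.single i 1) := by
  simp [lap, dirDeriv2, iteratedFDeriv_two_apply]

lemma tendsto_line {n : ℕ} (y e : E n) : Tendsto (fun s : ℝ => y + s • e) (𝓝 0) (𝓝 y) := by
  have : Continuous fun s : ℝ => y + s • e := by fun_prop
  simpa using this.tendsto 0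

lemma hasDerivAt_line {n : ℕ} (y e : E n) (s : ℝ) :
    HasDerivAt (fun s : ℝ => y + s • e) e s := by
  simpa using ((hasDerivAt_id s).smul_const e).const_add y

lemma eventually_hasDerivAt_line {n : ℕ} {u : E n → ℝ} {y : E n} (hu : ContDiffAt ℝ 2 u y)
    (e : E n) :
    ∀ᶠ s in 𝓝 (0 : ℝ),
      HasDerivAt (fun s : ℝ => u (y + s • e)) (fderiv ℝ u (y + s • e) e) s := by
  have h1 : ∀ᶠ z in 𝓝 y, ContDiffAt ℝ 2 u z := hu.eventually (by simp)
  filter_upwards [(tendsto_line y e).eventually h1] with s hs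
  exact (hs.differentiableAt (by norm_num)).hasFDerivAt.comp_hasDerivAt s (hasDerivAt_line y e s)

lemma hasDerivAt_fderiv_line {n : ℕ} {u : E n → ℝ} {y : E n} (hu : ContDiffAt ℝ 2 u y)
    (e : E n) :
    HasDerivAt (fun s : ℝ => fderiv ℝ u (y + s • e) e) (dirDeriv2 u y e) 0 := by
  have h1 : ContDiffAt ℝ 1 (fderiv ℝ u) y := hu.fderiv_right (by norm_num)
  have h2 : HasFDerivAt (fderiv ℝ u) (fderiv ℝ (fderiv ℝ u) y) (y + (0 : ℝ) • e) := by
    simpa using (h1.differentiableAt (by norm_num)).hasFDerivAt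
  have h3 : HasDerivAt (fun s : ℝ => fderiv ℝ u (y + s • e)) (fderiv ℝ (fderiv ℝ u) y e) 0 :=
    h2.comp_hasDerivAt (0 : ℝ) (hasDerivAt_line y e 0)
  have h4 := h3.clm_apply (hasDerivAt_const (0 : ℝ) e)
  rw [map_zero, add_zero] at h4
  exact h4

lemma norm_sq_line {n : ℕ} (x y : E n) (i : Fin n) (s : ℝ) :
    ‖y + s • EuclideanSpace.single i (1 : ℝ) - x‖ ^ 2
      = ‖y - x‖ ^ 2 + 2 * s * (y i - x i) + s ^ 2 := by
  rw [show y + s • EuclideanSpace.single i (1 : ℝ) - x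
    = (y - x) + s • EuclideanSpace.single i (1 : ℝ) by abel, norm_add_sq_real,
    inner_smul_right, EuclideanSpace.inner_single_right, norm_smul, mul_pow]
  simp
  ring

lemma hasDerivAt_norm_sq_line {n : ℕ} (x y : E n) (i : Fin n) (s : ℝ) :
    HasDerivAt (fun s : ℝ => ‖y + s • EuclideanSpace.single i (1 : ℝ) - x‖ ^ 2)
      (2 * (y i - x i) + 2 * s) s := by
  simp only [norm_sq_line]
  have := (((hasDerivAt_id s).const_mul 2).mul_const (y i - x i)).const_add (‖y - x‖ ^ 2)
    |>.add ((hasDerivAt_id s).pow 2)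
  refine this.congr_deriv ?_
  simp

lemma IsLocalMin.comp_line {n : ℕ} {v : E n → ℝ} {y : E n} (h : IsLocalMin v y) (e : E n) :
    IsLocalMin (fun s : ℝ => v (y + s • e)) 0 := by
  filter_upwards [(tendsto_line y e).eventually h] with s hs
  change v (y + (0 : ℝ) • e) ≤ v (y + s • e)
  rwa [zero_smul, add_zero]

/-- If `-Δu ≥ c` on a ball of radius `R` then `u` at the centre is at least of order `c R²`. -/
lemma torsion_bound {n : ℕ} (hn : 0 < n) {u : E n → ℝ} {x₀ : E n} {R c : ℝ}
    (hR : 0 < R) (hc : 0 < c) (hu : ∀ x ∈ closedBall x₀ R, ContDiffAt ℝ 2 u x)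
    (hpos : ∀ x ∈ closedBall x₀ R, 0 < u x)
    (hlap : ∀ x ∈ closedBall x₀ R, lap u x ≤ -c) :
    c * R ^ 2 ≤ 4 * n * u x₀ := by
  have hn' : (0 : ℝ) < n := by exact_mod_cast hn
  set a := c / (4 * n) with ha
  have hac : 4 * n * a = c := by rw [ha]; field_simp
  have hcont : ContinuousOn (fun z => u z + a * ‖z - x₀‖ ^ 2) (closedBall x₀ R) := by
    have : ContinuousOn u (closedBall x₀ R) :=
      fun z hz => (hu z hz).continuousAt.continuousWithinAt
    fun_prop
  obtain ⟨y, hy, hmin⟩ := (isCompact_closedBall x₀ R).exists_isMinOn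
    ⟨x₀, mem_closedBall_self hR.le⟩ hcont
  have hy0 := hmin (mem_closedBall_self hR.le)
  simp only [mem_ofPred_eq, sub_self, norm_zero] at hy0
  have huy := hpos y hy
  have hyR : ‖y - x₀‖ ≤ R := by simpa [dist_eq_norm] using hy
  rcases hyR.lt_or_eq with hlt | heq
  · exfalso
    have hloc : IsLocalMin (fun z => u z + a * ‖z - x₀‖ ^ 2) y :=
      hmin.isLocalMin (mem_of_superset (isOpen_ball.mem_nhds
        (by simpa [dist_eq_norm] using hlt : y ∈ ball x₀ R)) ball_subset_closedBall)
    have key : ∀ i : Fin n, 0 ≤ dirDeriv2 u y (EuclideanSpace.single i 1) + a * 2 := by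
      intro i
      refine (second_derivative_test
        (φ' := fun s => fderiv ℝ u (y + s • EuclideanSpace.single i (1 : ℝ))
            (EuclideanSpace.single i 1) + a * (2 * (y i - x₀ i) + 2 * s)) ?_ ?_
        (hloc.comp_line (EuclideanSpace.single i 1))).2
      · filter_upwards [eventually_hasDerivAt_line (hu y hy) (EuclideanSpace.single i 1)] with s hs
        exact hs.add ((hasDerivAt_norm_sq_line x₀ y i s).const_mul a)
      · refine (hasDerivAt_fderiv_line (hu y hy) _).add (HasDerivAt.const_mul a ?_)
        simpa using ((hasDerivAt_id (0 : ℝ)).const_mul 2).const_add (2 * (y i - x₀ i))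
    have hsum := Finset.sum_nonneg fun i (_ : i ∈ Finset.univ) => key i
    rw [Finset.sum_add_distrib, ← lap_eq_sum_dirDeriv2] at hsum
    simp at hsum
    have := hlap y hy
    nlinarith
  · rw [heq] at hy0
    have : a * R ^ 2 ≤ u x₀ := by nlinarith
    rw [← hac]; nlinarith

lemma exists_touching_paraboloid {n : ℕ} {g : E n → ℝ} {x : E n} {ρ : ℝ} (hρ : 0 < ρ)
    (hg : ContinuousOn g (closedBall x ρ)) (hpos : ∀ z ∈ closedBall x ρ, 0 < g z) :
    ∃ y ∈ ball x ρ, ∃ κ : ℝ, 0 < κ ∧ κ * g y = ρ ^ 2 - ‖y - x‖ ^ 2 ∧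
      (∀ z ∈ closedBall x ρ, ρ ^ 2 - ‖z - x‖ ^ 2 ≤ κ * g z) := by
  have hcont : ContinuousOn (fun z => (ρ ^ 2 - ‖z - x‖ ^ 2) / g z) (closedBall x ρ) :=
    ContinuousOn.div (by fun_prop) hg fun z hz => (hpos z hz).ne'
  have hx : x ∈ closedBall x ρ := mem_closedBall_self hρ.le
  obtain ⟨y, hy, hmax⟩ := (isCompact_closedBall x ρ).exists_isMaxOn ⟨x, hx⟩ hcont
  have h0 := hmax hx
  simp only [mem_ofPred_eq, sub_self, norm_zero] at h0
  have hκ : 0 < (ρ ^ 2 - ‖y - x‖ ^ 2) / g y :=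
    lt_of_lt_of_le (div_pos (by simpa using pow_pos hρ 2) (hpos x hx)) h0
  have hnum : 0 < ρ ^ 2 - ‖y - x‖ ^ 2 := (div_pos_iff_of_pos_right (hpos y hy)).1 hκ
  refine ⟨y, ?_, _, hκ, div_mul_cancel₀ _ (hpos y hy).ne', fun z hz => ?_⟩
  · rw [mem_ball, dist_eq_norm]
    exact lt_of_pow_lt_pow_left₀ 2 hρ.le (by linarith)
  · exact (div_le_iff₀ (hpos z hz)).1 (hmax hz)

/-- Keller–Osserman type bound at a touching point. -/
lemma touching_bound {n : ℕ} {u : E n → ℝ} {x y : E n} {ρ κ g₀ f₀ α : ℝ}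
    (hκ : 0 < κ) (hg : 0 < g₀) (hα : 1 / 2 ≤ α)
    (hu : ContDiffAt ℝ 2 u y) (hpos : 0 < u y) (hfg : g₀ ^ 2 * f₀ = u y)
    (hlap : lap u y = -f₀) (heq : κ * g₀ = ρ ^ 2 - ‖y - x‖ ^ 2)
    (hle : ∀ᶠ z in 𝓝 y, ρ ^ 2 - ‖z - x‖ ^ 2 ≤ κ * (g₀ * (u z / u y) ^ α)) :
    κ ^ 2 ≤ (8 + 4 * n) * ρ ^ 2 := by
  set T := κ * g₀ with hT
  have hTpos : 0 < T := mul_pos hκ hg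
  have hloc : IsLocalMin (fun z => T * (u z / u y) ^ α + ‖z - x‖ ^ 2) y := by
    filter_upwards [hle] with z hz
    rw [div_self hpos.ne', Real.one_rpow]
    nlinarith
  have key : ∀ i : Fin n,
      T * (α * (fderiv ℝ u y (EuclideanSpace.single i 1) / u y)) + 2 * (y i - x i) = 0 ∧
      0 ≤ T * (α * ((α - 1) * (fderiv ℝ u y (EuclideanSpace.single i 1) / u y) ^ 2
        + dirDeriv2 u y (EuclideanSpace.single i 1) / u y)) + 2 := by
    intro i
    set e : E n := EuclideanSpace.single i 1 with he
    have h1 := eventually_hasDerivAt_line hu e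
    have h2 := hasDerivAt_fderiv_line hu e
    have hne : ∀ᶠ s in 𝓝 (0 : ℝ), 0 < u (y + s • e) :=
      (tendsto_line y e).eventually (hu.continuousAt.eventually (lt_mem_nhds hpos))
    have := second_derivative_test
        (φ' := fun s => T * (fderiv ℝ u (y + s • e) e / u y * α
            * (u (y + s • e) / u y) ^ (α - 1)) + (2 * (y i - x i) + 2 * s))
        (b := T * (dirDeriv2 u y e / u y * α * (u (y + (0 : ℝ) • e) / u y) ^ (α - 1)
          + fderiv ℝ u (y + (0 : ℝ) • e) e / u y * α *
           (fderiv ℝ u (y + (0 : ℝ) • e) e / u y * (α - 1)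
            * (u (y + (0 : ℝ) • e) / u y) ^ (α - 1 - 1))) + 2) ?_ ?_
        (hloc.comp_line e)
    · simp only [zero_smul, add_zero, div_self hpos.ne', Real.one_rpow] at this
      refine ⟨by linarith [this.1], by linarith [this.2]⟩
    · filter_upwards [h1, hne] with s hs hs'
      exact (((hs.div_const (u y)).rpow_const (Or.inl (div_pos hs' hpos).ne')).const_mul T).add
        (hasDerivAt_norm_sq_line x y i s)
    · refine HasDerivAt.add (HasDerivAt.const_mul T ?_) ?_
      · exact ((h2.div_const (u y)).mul_const α).mul
          ((h1.self_of_nhds.div_const (u y)).rpow_const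
            (Or.inl (div_pos hne.self_of_nhds hpos).ne'))
      · simpa using ((hasDerivAt_id (0 : ℝ)).const_mul 2).const_add (2 * (y i - x i))
  set p : Fin n → ℝ := fun i => fderiv ℝ u y (EuclideanSpace.single i 1) / u y with hp
  have hsq : T ^ 2 * α ^ 2 * ∑ i, p i ^ 2 = 4 * ‖y - x‖ ^ 2 := by
    rw [EuclideanSpace.norm_sq_eq, Finset.mul_sum, Finset.mul_sum]
    refine Finset.sum_congr rfl fun i _ => ?_
    have := (key i).1
    have h3 : T * α * p i = -(2 * (y i - x i)) := by simp only [hp]; linarith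
    calc T ^ 2 * α ^ 2 * p i ^ 2 = (T * α * p i) ^ 2 := by ring
      _ = _ := by rw [h3]; simp; ring
  have hsum := Finset.sum_nonneg fun i (_ : i ∈ Finset.univ) => (key i).2
  rw [Finset.sum_add_distrib, ← Finset.mul_sum, ← Finset.mul_sum, Finset.sum_add_distrib,
    ← Finset.mul_sum, ← Finset.sum_div, ← lap_eq_sum_dirDeriv2, hlap] at hsum
  simp only [Finset.sum_const, Finset.card_univ, Fintype.card_fin, nsmul_eq_mul] at hsum
  change 0 ≤ T * (α * ((α - 1) * ∑ i, p i ^ 2 + -f₀ / u y)) + n * 2 at hsum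
  have hS : 0 ≤ ∑ i, p i ^ 2 := Finset.sum_nonneg fun i _ => sq_nonneg _
  set S := ∑ i, p i ^ 2
  have hfu : T ^ 2 * (f₀ / u y) = κ ^ 2 := by
    rw [hT, ← hfg]
    have : f₀ ≠ 0 := by rintro rfl; simp at hfg; linarith
    field_simp
  have hmul : 0 ≤ T * (T * (α * ((α - 1) * S + -f₀ / u y)) + n * 2) := mul_nonneg hTpos.le hsum
  have hTρ : T ≤ ρ ^ 2 := by rw [heq]; linarith [sq_nonneg ‖y - x‖]
  have hy : ‖y - x‖ ^ 2 ≤ ρ ^ 2 := by linarith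
  have e1 : T * (T * (α * ((α - 1) * S + -f₀ / u y)) + n * 2)
      = T ^ 2 * α ^ 2 * S - α * (T ^ 2 * S) - α * (T ^ 2 * (f₀ / u y)) + 2 * n * T := by ring
  rw [e1, hsq, hfu] at hmul
  have h4 : 0 ≤ α * (T ^ 2 * S) := by positivity
  have h5 : (n : ℝ) * T ≤ n * ρ ^ 2 := by gcongr
  nlinarith [sq_nonneg κ]

/-- Reflection across the hyperplane through `x` orthogonal to the `i`-th coordinate axis. -/
noncomputable def coordReflection {n : ℕ} (x : E n) (i : Fin n) (z : E n) : E n :=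
  z - (2 * (z i - x i)) • EuclideanSpace.single i (1 : ℝ)

lemma norm_coordReflection_sub {n : ℕ} (x : E n) (i : Fin n) (z : E n) :
    ‖coordReflection x i z - x‖ = ‖z - x‖ := by
  rw [← sq_eq_sq₀ (norm_nonneg _) (norm_nonneg _), coordReflection, sub_eq_add_neg z, ← neg_smul,
    norm_sq_line]
  ring

lemma continuous_coordReflection {n : ℕ} (x : E n) (i : Fin n) :
    Continuous (coordReflection x i) := by
  unfold coordReflection
  fun_prop

lemma coordReflection_line_self {n : ℕ} (x : E n) (i : Fin n) (z : E n) (s : ℝ) :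
    coordReflection x i (z + s • EuclideanSpace.single i (1 : ℝ))
      = coordReflection x i z + s • (-EuclideanSpace.single i (1 : ℝ)) := by
  simp only [coordReflection, PiLp.add_apply, PiLp.smul_apply, PiLp.single_apply, smul_eq_mul,
    if_true]
  module

lemma coordReflection_line_of_ne {n : ℕ} (x : E n) {i j : Fin n} (hij : i ≠ j) (z : E n) (s : ℝ) :
    coordReflection x i (z + s • EuclideanSpace.single j (1 : ℝ))
      = coordReflection x i z + s • EuclideanSpace.single j (1 : ℝ) := by
  simp only [coordReflection, PiLp.add_apply, PiLp.smul_apply, PiLp.single_apply, smul_eq_mul,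
    if_neg hij]
  module

lemma exists_coordReflection_line {n : ℕ} (x : E n) (i j : Fin n) :
    ∃ e' : E n, (∀ (u : E n → ℝ) (y : E n),
      dirDeriv2 u y e' = dirDeriv2 u y (EuclideanSpace.single j 1)) ∧
      ∀ (z : E n) (s : ℝ), coordReflection x i (z + s • EuclideanSpace.single j (1 : ℝ))
        = coordReflection x i z + s • e' := by
  by_cases hij : i = j
  · subst hij
    exact ⟨_, fun u y => dirDeriv2_neg u y _, coordReflection_line_self x i⟩
  · exact ⟨_, fun _ _ => rfl, coordReflection_line_of_ne x hij⟩

lemma reflection_barrier {n : ℕ} {u : E n → ℝ} {x : E n} {ρ M N : ℝ} (hρ : 0 < ρ)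
    (hM : 0 < M) (hN : 0 < N) (hu : ∀ z ∈ closedBall x ρ, ContDiffAt ℝ 2 u z)
    (huM : ∀ z ∈ closedBall x ρ, |u z| ≤ M) (hlap : ∀ z ∈ closedBall x ρ, |lap u z| ≤ N)
    (i : Fin n) {z : E n} (hz : z ∈ closedBall x ρ) (hzi : x i ≤ z i) :
    0 ≤ (M / ρ ^ 2) * ‖z - x‖ ^ 2 + (n * (M / ρ ^ 2) + N) * (ρ * (z i - x i) - (z i - x i) ^ 2)
      - (u z - u (coordReflection x i z)) / 2 := by
  set A := M / ρ ^ 2 with hA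
  set D := n * A + N with hD
  have hAρ : A * ρ ^ 2 = M := by rw [hA]; field_simp
  have hApos : 0 < A := by positivity
  have hDpos : 0 < D := by positivity
  set W : E n → ℝ := fun z => A * ‖z - x‖ ^ 2 + D * (ρ * (z i - x i) - (z i - x i) ^ 2)
      - (u z - u (coordReflection x i z)) / 2 with hW
  set σ := coordReflection x i with hσ
  have hσmem : ∀ z ∈ closedBall x ρ, σ z ∈ closedBall x ρ := by
    intro z hz
    rw [mem_closedBall, dist_eq_norm] at hz ⊢
    rwa [hσ, norm_coordReflection_sub]
  have hcontu : ContinuousOn u (closedBall x ρ) :=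
    fun z hz => (hu z hz).continuousAt.continuousWithinAt
  have hcont : ContinuousOn W (closedBall x ρ) := by
    have h2 : ContinuousOn (fun z => u (σ z)) (closedBall x ρ) :=
      hcontu.comp (continuous_coordReflection x i).continuousOn hσmem
    have h3 : ContinuousOn (fun z : E n => A * ‖z - x‖ ^ 2
        + D * (ρ * (z i - x i) - (z i - x i) ^ 2)) (closedBall x ρ) :=
      Continuous.continuousOn (by fun_prop)
    exact h3.sub ((hcontu.sub h2).div_const 2)
  have hclosed : IsClosed {z : E n | x i ≤ z i} := isClosed_le (by fun_prop) (by fun_prop)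
  obtain ⟨y, ⟨hy, hyi⟩, hmin⟩ := ((isCompact_closedBall x ρ).inter_right hclosed).exists_isMinOn
    ⟨z, hz, hzi⟩ (hcont.mono inter_subset_left)
  refine le_trans ?_ (hmin ⟨hz, hzi⟩)
  change 0 ≤ W y
  have hyi : x i ≤ y i := hyi
  have hyρ : ‖y - x‖ ≤ ρ := by simpa [dist_eq_norm] using hy
  have hcoord : |y i - x i| ≤ ‖y - x‖ := by
    simpa using PiLp.norm_apply_le (y - x) i
  have hti : y i - x i ≤ ρ := (le_abs_self _).trans (hcoord.trans hyρ)
  rcases hyi.eq_or_lt with h0 | hlt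
  · have : σ y = y := by simp [hσ, coordReflection, h0]
    simp only [hW]
    rw [this, ← h0]
    simp
    positivity
  rcases hyρ.eq_or_lt with h1 | hlt'
  · have a1 := abs_le.1 (huM y hy)
    have a2 := abs_le.1 (huM _ (hσmem y hy))
    have a3 : 0 ≤ D * (ρ * (y i - x i) - (y i - x i) ^ 2) :=
      mul_nonneg hDpos.le (by nlinarith)
    simp only [hW]
    rw [h1, hAρ]
    linarith
  · exfalso
    have hnhds : closedBall x ρ ∩ {z : E n | x i ≤ z i} ∈ 𝓝 y := by
      refine inter_mem (mem_of_superset (isOpen_ball.mem_nhds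
        (by simpa [dist_eq_norm] using hlt' : y ∈ ball x ρ)) ball_subset_closedBall) ?_
      have : IsOpen {z : E n | x i < z i} := isOpen_lt (by fun_prop) (by fun_prop)
      exact mem_of_superset (this.mem_nhds hlt) fun z (hz : x i < z i) => hz.le
    have hloc : IsLocalMin W y := hmin.isLocalMin hnhds
    have key : ∀ j : Fin n, 0 ≤ 2 * A - 2 * D * (if i = j then 1 else 0)
        - (dirDeriv2 u y (EuclideanSpace.single j 1)
          - dirDeriv2 u (σ y) (EuclideanSpace.single j 1)) / 2 := by
      intro j
      obtain ⟨e', he', hline⟩ := exists_coordReflection_line x i j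
      set e : E n := EuclideanSpace.single j 1 with he
      set δ : ℝ := if i = j then 1 else 0 with hδ
      have hδδ : δ * δ = δ := by rw [hδ]; split_ifs <;> simp
      have hcoordline : ∀ s : ℝ, (y + s • e) i - x i = (y i - x i) + s * δ := by
        intro s
        simp only [he, hδ, PiLp.add_apply, PiLp.smul_apply, PiLp.single_apply, smul_eq_mul]
        ring
      have hfun : (fun s : ℝ => W (y + s • e)) = fun s : ℝ =>
          A * ‖y + s • e - x‖ ^ 2 + D * (ρ * ((y i - x i) + s * δ) - ((y i - x i) + s * δ) ^ 2)
            - (u (y + s • e) - u (σ y + s • e')) / 2 := by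
        funext s
        simp only [hW, hσ, hcoordline, hline]
      have hm := hloc.comp_line e
      rw [hfun] at hm
      have hlin : ∀ s : ℝ, HasDerivAt (fun s : ℝ => (y i - x i) + s * δ) δ s := fun s => by
        simpa using ((hasDerivAt_id s).mul_const δ).const_add (y i - x i)
      have := (second_derivative_test
        (φ' := fun s => A * (2 * (y j - x j) + 2 * s)
          + D * (ρ * δ - 2 * ((y i - x i) + s * δ) * δ)
          - (fderiv ℝ u (y + s • e) e - fderiv ℝ u (σ y + s • e') e') / 2)
        (b := A * 2 + D * (0 - 2 * δ * δ) - (dirDeriv2 u y e - dirDeriv2 u (σ y) e') / 2)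
        ?_ ?_ hm).2
      · rw [he'] at this
        linear_combination this - 2 * D * hδδ
      · filter_upwards [eventually_hasDerivAt_line (hu y hy) e,
          eventually_hasDerivAt_line (hu _ (hσmem y hy)) e'] with s h1 h2
        refine (((hasDerivAt_norm_sq_line x y j s).const_mul A).add
          (HasDerivAt.const_mul D (((hlin s).const_mul ρ).sub ?_))).sub ((h1.sub h2).div_const 2)
        exact ((hlin s).fun_pow 2).congr_deriv (by simp)
      · refine ((HasDerivAt.const_mul A ?_).add (HasDerivAt.const_mul D
          ((hasDerivAt_const _ _).sub (((hlin 0).const_mul 2).mul_const δ)))).sub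
          (((hasDerivAt_fderiv_line (hu y hy) e).sub
            (hasDerivAt_fderiv_line (hu _ (hσmem y hy)) e')).div_const 2)
        simpa using ((hasDerivAt_id (0 : ℝ)).const_mul 2).const_add (2 * (y j - x j))
    have hsum := Finset.sum_nonneg fun i (_ : i ∈ Finset.univ) => key i
    rw [Finset.sum_sub_distrib, Finset.sum_sub_distrib, ← Finset.mul_sum Finset.univ _ (2 * D),
      ← Finset.sum_div, Finset.sum_sub_distrib, ← lap_eq_sum_dirDeriv2, ← lap_eq_sum_dirDeriv2] at hsum
    simp only [Finset.sum_const, Finset.card_univ, Fintype.card_fin, nsmul_eq_mul,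
      Finset.sum_ite_eq, Finset.mem_univ, if_true] at hsum
    have a1 := abs_le.1 (hlap y hy)
    have a2 := abs_le.1 (hlap _ (hσmem y hy))
    linarith

lemma fderiv_single_le {n : ℕ} {u : E n → ℝ} {x : E n} {ρ M N : ℝ} (hρ : 0 < ρ)
    (hM : 0 < M) (hN : 0 < N) (hu : ∀ z ∈ closedBall x ρ, ContDiffAt ℝ 2 u z)
    (huM : ∀ z ∈ closedBall x ρ, |u z| ≤ M) (hlap : ∀ z ∈ closedBall x ρ, |lap u z| ≤ N)
    (i : Fin n) :
    fderiv ℝ u x (EuclideanSpace.single i 1) ≤ (n * (M / ρ ^ 2) + N) * ρ := by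
  set e : E n := EuclideanSpace.single i 1 with he
  set A := M / ρ ^ 2
  set D := n * A + N
  have hx : x ∈ closedBall x ρ := mem_closedBall_self hρ.le
  have hd : HasDerivAt (fun s : ℝ => A * ‖x + s • e - x‖ ^ 2 + D * (ρ * s - s ^ 2)
      - (u (x + s • e) - u (x + s • (-e))) / 2) (D * ρ - fderiv ℝ u x e) 0 := by
    have h1 := (eventually_hasDerivAt_line (hu x hx) e).self_of_nhds
    have h2 := (eventually_hasDerivAt_line (hu x hx) (-e)).self_of_nhds
    have := (((hasDerivAt_norm_sq_line x x i 0).const_mul A).add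
          (HasDerivAt.const_mul D (((hasDerivAt_id (0 : ℝ)).const_mul ρ).sub
            ((hasDerivAt_id (0 : ℝ)).pow 2)))).sub ((h1.sub h2).div_const 2)
    refine this.congr_deriv ?_
    simp
  have hnonneg : ∀ᶠ s in 𝓝[>] (0 : ℝ), 0 ≤ A * ‖x + s • e - x‖ ^ 2 + D * (ρ * s - s ^ 2)
      - (u (x + s • e) - u (x + s • (-e))) / 2 := by
    filter_upwards [Ioo_mem_nhdsGT hρ] with s hs
    have hmem : x + s • e ∈ closedBall x ρ := by
      simp [dist_eq_norm, he, norm_smul, abs_of_pos hs.1, hs.2.le]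
    have hcoord : (x + s • e) i - x i = s := by simp [he]
    have hrefl : coordReflection x i (x + s • e) = x + s • (-e) := by
      rw [he, coordReflection_line_self]; simp [coordReflection]
    have := reflection_barrier hρ hM hN hu huM hlap i hmem (by linarith [hs.1])
    rwa [hcoord, hrefl] at this
  have hslope := hasDerivWithinAt_iff_tendsto_slope.1 (hd.hasDerivWithinAt (s := Ioi 0))
  have : 0 ≤ D * ρ - fderiv ℝ u x e := by
    refine ge_of_tendsto (by simpa using hslope) ?_
    filter_upwards [hnonneg, self_mem_nhdsWithin] with s hs hs0
    rw [slope_def_field]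
    refine div_nonneg ?_ (by simpa using le_of_lt hs0)
    simpa using hs
  linarith

lemma abs_fderiv_single_le {n : ℕ} {u : E n → ℝ} {x : E n} {ρ M N : ℝ} (hρ : 0 < ρ)
    (hM : 0 < M) (hN : 0 < N) (hu : ∀ z ∈ closedBall x ρ, ContDiffAt ℝ 2 u z)
    (huM : ∀ z ∈ closedBall x ρ, |u z| ≤ M) (hlap : ∀ z ∈ closedBall x ρ, |lap u z| ≤ N)
    (i : Fin n) :
    |fderiv ℝ u x (EuclideanSpace.single i 1)| ≤ (n * (M / ρ ^ 2) + N) * ρ := by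
  have hneg : ∀ z, lap (fun z => -u z) z = -lap u z := fun z => by
    have h1 : fderiv ℝ (fun z => -u z) = fun z => -fderiv ℝ u z := by
      funext w; exact fderiv_fun_neg
    simp [lap_eq_sum_dirDeriv2, dirDeriv2, h1, fderiv_fun_neg]
  have := fderiv_single_le hρ hM hN (fun z hz => (hu z hz).neg)
    (fun z hz => by simpa using huM z hz) (fun z hz => by
      have := hlap z hz
      rwa [← abs_neg, ← hneg] at this) i
  rw [abs_le]
  refine ⟨?_, fderiv_single_le hρ hM hN hu huM hlap i⟩
  simp at this
  linarith

lemma norm_gradient_sq {n : ℕ} {u : E n → ℝ} {x : E n} :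
    ‖gradient u x‖ ^ 2 = ∑ i, (fderiv ℝ u x (EuclideanSpace.single i 1)) ^ 2 := by
  rw [EuclideanSpace.norm_sq_eq]
  refine Finset.sum_congr rfl fun i _ => ?_
  have : fderiv ℝ u x (EuclideanSpace.single i 1) = gradient u x i := by
    have h := EuclideanSpace.inner_single_right (𝕜 := ℝ) i 1 (gradient u x)
    rw [gradient, InnerProductSpace.toDual_symm_apply] at h
    simpa [gradient] using h
  rw [this]
  simp

/-- A function whose logarithmic elasticity is monotone lies above its osculating powers. -/
lemma power_lower_bound {f : ℝ → ℝ} (hf : DifferentiableOn ℝ f (Ioi 0))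
    (hpos : ∀ t : ℝ, 0 < t → 0 < f t)
    (hmono : ∀ s t : ℝ, 0 < s → s ≤ t → s * deriv f s / f s ≤ t * deriv f t / f t)
    {s t : ℝ} (hs : 0 < s) (ht : 0 < t) :
    f t * (s / t) ^ (t * deriv f t / f t) ≤ f s := by
  set l := t * deriv f t / f t with hl
  set F : ℝ → ℝ := fun r => Real.log (f r) - l * Real.log r with hF
  have hder : ∀ r : ℝ, 0 < r → HasDerivAt F ((r * deriv f r / f r - l) / r) r := by
    intro r hr
    have h1 := ((hf r hr).differentiableAt (Ioi_mem_nhds hr)).hasDerivAt.log (hpos r hr).ne'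
    refine (h1.sub ((Real.hasDerivAt_log hr.ne').const_mul l)).congr_deriv ?_
    field_simp
  have hle : F t ≤ F s := by
    rcases le_total s t with hst | hst
    · refine antitoneOn_of_deriv_nonpos (convex_Icc s t)
        (fun r hr => (hder r (hs.trans_le hr.1)).continuousAt.continuousWithinAt)
        (fun r hr => ?_) (fun r hr => ?_) (left_mem_Icc.2 hst) (right_mem_Icc.2 hst) hst
      all_goals
        rw [interior_Icc] at hr
        have hr0 := hs.trans hr.1
      · exact (hder r hr0).differentiableAt.differentiableWithinAt
      · rw [(hder r hr0).deriv]
        exact div_nonpos_of_nonpos_of_nonneg (by linarith [hmono r t hr0 hr.2.le]) hr0.le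
    · refine monotoneOn_of_deriv_nonneg (convex_Icc t s)
        (fun r hr => (hder r (ht.trans_le hr.1)).continuousAt.continuousWithinAt)
        (fun r hr => ?_) (fun r hr => ?_) (left_mem_Icc.2 hst) (right_mem_Icc.2 hst) hst
      all_goals
        rw [interior_Icc] at hr
        have hr0 := ht.trans hr.1
      · exact (hder r hr0).differentiableAt.differentiableWithinAt
      · rw [(hder r hr0).deriv]
        exact div_nonneg (by linarith [hmono t r ht hr.1.le]) hr0.le
  have hst : 0 < s / t := div_pos hs ht
  rw [← Real.log_le_log_iff (mul_pos (hpos t ht) (Real.rpow_pos_of_pos hst _)) (hpos s hs),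
    Real.log_mul (hpos t ht).ne' (Real.rpow_pos_of_pos hst _).ne', Real.log_rpow hst,
    Real.log_div hs.ne' ht.ne']
  simp only [hF] at hle
  linarith

lemma source_bound {n : ℕ} (hn : 0 < n) {Λ₀ : ℝ} {f : ℝ → ℝ}
    (hf : DifferentiableOn ℝ f (Ioi 0)) (hpos : ∀ t : ℝ, 0 < t → 0 < f t)
    (hΛ : ∀ t : ℝ, 0 < t → t * deriv f t / f t ≤ Λ₀)
    (hmono : ∀ s t : ℝ, 0 < s → s ≤ t → s * deriv f s / f s ≤ t * deriv f t / f t)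
    {x₀ : E n} {R C_H : ℝ} (hR : 0 < R) (hC : 1 ≤ C_H) {u : E n → ℝ}
    (hu : ∀ x ∈ ball x₀ (2 * R), ContDiffAt ℝ 2 u x)
    (hupos : ∀ x ∈ ball x₀ (2 * R), 0 < u x)
    (heq : ∀ x ∈ ball x₀ (2 * R), lap u x + f (u x) = 0)
    (hH : ∀ x ∈ ball x₀ (2 * R), ∀ y ∈ ball x₀ (2 * R), u x ≤ C_H * u y)
    {x : E n} (hx : x ∈ ball x₀ (3 / 2 * R)) :
    f (u x) / u x ≤ (128 + 68 * n) * C_H ^ (1 + max Λ₀ 0) / R ^ 2 := by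
  have hn' : (0 : ℝ) < n := by exact_mod_cast hn
  have hsub : closedBall x (R / 4) ⊆ ball x₀ (2 * R) := by
    refine closedBall_subset_ball' ?_
    rw [mem_ball] at hx
    linarith
  have hsub₀ : closedBall x₀ R ⊆ ball x₀ (2 * R) := closedBall_subset_ball (by linarith)
  have hx2 : x ∈ ball x₀ (2 * R) := hsub (mem_closedBall_self (by positivity))
  have hC0 : 0 < C_H := by linarith
  have hCβ : 1 ≤ C_H ^ (1 + max Λ₀ 0) := Real.one_le_rpow hC (by positivity)
  have hfu : ∀ z ∈ ball x₀ (2 * R), 0 < u z / f (u z) := fun z hz =>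
    div_pos (hupos z hz) (hpos _ (hupos z hz))
  have hgcont : ContinuousOn (fun z => √(u z / f (u z))) (closedBall x (R / 4)) := by
    have h1 : ContinuousOn u (closedBall x (R / 4)) :=
      fun z hz => (hu z (hsub hz)).continuousAt.continuousWithinAt
    have h2 : ContinuousOn (fun z => f (u z)) (closedBall x (R / 4)) :=
      hf.continuousOn.comp h1 fun z hz => hupos z (hsub hz)
    exact (h1.div h2 fun z hz => (hpos _ (hupos z (hsub hz))).ne').sqrt
  obtain ⟨y, hy, κ, hκ, hκy, hκle⟩ := exists_touching_paraboloid (by positivity : 0 < R / 4) hgcont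
    fun z hz => Real.sqrt_pos.2 (hfu z (hsub hz))
  have hy2 : y ∈ ball x₀ (2 * R) := hsub (ball_subset_closedBall hy)
  have hκx := hκle x (mem_closedBall_self (by positivity))
  simp only [sub_self, norm_zero] at hκx
  have huy := hupos y hy2
  have hux := hupos x hx2
  have hfy := hpos _ huy
  have hfx := hpos _ hux
  set l := u y * deriv f (u y) / f (u y) with hl
  rcases le_or_gt l 0 with hl0 | hl0
  · have htouch := touching_bound (g₀ := √(u y / f (u y))) (f₀ := f (u y)) (α := (1 - l) / 2)
      hκ (Real.sqrt_pos.2 (hfu y hy2)) (by linarith) (hu y hy2) huy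
      (by rw [Real.sq_sqrt (hfu y hy2).le]; field_simp) (by linarith [heq y hy2]) hκy (by
        filter_upwards [isOpen_ball.mem_nhds hy] with z hz
        have hz' := ball_subset_closedBall hz
        refine (hκle z hz').trans (mul_le_mul_of_nonneg_left ?_ hκ.le)
        have huz := hupos z (hsub hz')
        have hr : 0 < u z / u y := div_pos huz huy
        have hpow := power_lower_bound hf hpos hmono huz huy
        rw [← hl] at hpow
        refine Real.sqrt_le_iff.2 ⟨mul_nonneg (Real.sqrt_nonneg _) (Real.rpow_nonneg hr.le _), ?_⟩
        rw [mul_pow, Real.sq_sqrt (hfu y hy2).le, ← Real.rpow_natCast, ← Real.rpow_mul hr.le,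
          show (1 - l) / 2 * ((2 : ℕ) : ℝ) = 1 - l by push_cast; ring, Real.rpow_sub hr,
          Real.rpow_one]
        have hrl : 0 < (u z / u y) ^ l := Real.rpow_pos_of_pos hr l
        calc u z / f (u z) ≤ u z / (f (u y) * (u z / u y) ^ l) := by gcongr
          _ = _ := by field_simp)
    have hsq : ((R / 4) ^ 2) ^ 2 ≤ κ ^ 2 * (u x / f (u x)) := by
      have := pow_le_pow_left₀ (by simp [sq_nonneg]) hκx 2
      rw [mul_pow κ, Real.sq_sqrt (hfu x hx2).le] at this
      simpa using this
    have h1 : ((R / 4) ^ 2) ^ 2 ≤ (8 + 4 * n) * (R / 4) ^ 2 * (u x / f (u x)) :=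
      hsq.trans (by gcongr)
    have h2 : (R / 4) ^ 2 ≤ (8 + 4 * n) * (u x / f (u x)) := by
      have : 0 < (R / 4) ^ 2 := by positivity
      nlinarith
    have h3 : f (u x) / u x ≤ (128 + 64 * n) * 1 / R ^ 2 := by
      rw [div_le_div_iff₀ hux (by positivity)]
      have h4 := mul_le_mul_of_nonneg_right h2 hfx.le
      rw [mul_assoc, div_mul_cancel₀ _ hfx.ne'] at h4
      linarith
    refine h3.trans ?_
    gcongr
    norm_num
  · have hlΛ : l ≤ max Λ₀ 0 := (hΛ _ huy).trans (le_max_left _ _)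
    have hlow : ∀ z ∈ ball x₀ (2 * R), f (u y) / C_H ^ max Λ₀ 0 ≤ f (u z) := by
      intro z hz
      have huz := hupos z hz
      refine le_trans ?_ (power_lower_bound hf hpos hmono huz huy)
      rw [← hl, div_eq_mul_inv]
      gcongr
      have hr : C_H⁻¹ ≤ u z / u y := by
        rw [inv_le_comm₀ hC0 (div_pos huz huy), inv_div]
        exact (div_le_iff₀ huz).2 (hH y hy2 z hz)
      calc (C_H ^ max Λ₀ 0)⁻¹ ≤ (C_H ^ l)⁻¹ := by gcongr
        _ = (C_H⁻¹) ^ l := (Real.inv_rpow hC0.le l).symm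
        _ ≤ _ := by gcongr
    have htor := torsion_bound hn hR (c := f (u y) / C_H ^ max Λ₀ 0) (by positivity)
      (fun z hz => hu z (hsub₀ hz)) (fun z hz => hupos z (hsub₀ hz))
      (fun z hz => by linarith [heq z (hsub₀ hz), hlow z (hsub₀ hz)])
    have hx₀ := hH x₀ (hsub₀ (mem_closedBall_self hR.le)) y hy2
    have h1 : f (u y) * R ^ 2 ≤ 4 * n * (C_H ^ (1 + max Λ₀ 0) * u y) := by
      have hP : 0 < C_H ^ max Λ₀ 0 := by positivity
      have h2 := mul_le_mul_of_nonneg_right htor hP.le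
      rw [div_mul_eq_mul_div, div_mul_cancel₀ _ hP.ne'] at h2
      refine h2.trans ?_
      rw [Real.rpow_add hC0, Real.rpow_one]
      calc 4 * n * u x₀ * C_H ^ max Λ₀ 0 ≤ 4 * n * (C_H * u y) * C_H ^ max Λ₀ 0 := by gcongr
        _ = _ := by ring
    have h2 : f (u y) / u y ≤ 4 * n * C_H ^ (1 + max Λ₀ 0) / R ^ 2 := by
      rw [div_le_div_iff₀ huy (by positivity)]
      linarith
    have hgyx : √(u y / f (u y)) ≤ √(u x / f (u x)) := by
      refine le_of_mul_le_mul_left ?_ hκ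
      linarith [sq_nonneg ‖y - x‖]
    have h3 : u y / f (u y) ≤ u x / f (u x) := (Real.sqrt_le_sqrt_iff (hfu x hx2).le).1 hgyx
    have h4 : f (u x) / u x ≤ f (u y) / u y := by
      rw [← inv_div, ← inv_div (u y)]
      exact inv_anti₀ (hfu y hy2) h3
    refine (h4.trans h2).trans ?_
    gcongr
    linarith

/-- the Harnack inequality implies the universal boundedness estimate,
for positive `f` with `sup t f'/f ≤ Λ₀ < p_S(n)` and `t ↦ t f'/f` non-decreasing. -/
theorem stmt10 (n : ℕ) (hn : 0 < n) (Λ₀ : ℝ)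
    (hΛp : 2 < n → Λ₀ < ((n : ℝ) + 2) / ((n : ℝ) - 2)) :
    ∃ β C : ℝ, 0 < β ∧ 0 < C ∧
      ∀ f : ℝ → ℝ, ContDiffOn ℝ 2 f (Ioi 0) →
        (∀ t : ℝ, 0 < t → 0 < f t) →
        (∀ t : ℝ, 0 < t → t * deriv f t / f t ≤ Λ₀) →
        (∀ s t : ℝ, 0 < s → s ≤ t → s * deriv f s / f s ≤ t * deriv f t / f t) →
        ∀ (x₀ : E n) (R C_H : ℝ), 0 < R → 1 ≤ C_H →
          ∀ u : E n → ℝ, ContDiffOn ℝ 2 u (ball x₀ (2 * R)) →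
            (∀ x ∈ ball x₀ (2 * R), 0 < u x) →
            (∀ x ∈ ball x₀ (2 * R), lap u x + f (u x) = 0) →
            (∀ x ∈ ball x₀ (2 * R), ∀ y ∈ ball x₀ (2 * R), u x ≤ C_H * u y) →
            ∀ x ∈ ball x₀ R,
              ‖gradient u x‖ ^ 2 / (u x) ^ 2 + f (u x) / u x ≤ C * C_H ^ β / R ^ 2 := by
  have hn' : (0 : ℝ) < n := by exact_mod_cast hn
  set γ : ℝ := 1 + max Λ₀ 0 with hγ
  have hγ1 : 1 ≤ γ := by rw [hγ]; linarith [le_max_right Λ₀ 0]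
  set a : ℝ := 128 + 68 * n with ha
  refine ⟨2 + 2 * γ, n * (4 * n + a) ^ 2 + a, by positivity, by positivity, ?_⟩
  intro f hf hpos hΛ hmono x₀ R C_H hR hC u hu hupos heq hH x hx
  have hC0 : 0 < C_H := by linarith
  have hfd : DifferentiableOn ℝ f (Ioi 0) := hf.differentiableOn (by norm_num)
  have hu' : ∀ x ∈ ball x₀ (2 * R), ContDiffAt ℝ 2 u x := fun z hz =>
    hu.contDiffAt (isOpen_ball.mem_nhds hz)
  set K : ℝ := a * C_H ^ γ / R ^ 2 with hK
  have hKpos : 0 < K := by positivity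
  have hsource : ∀ z ∈ ball x₀ (3 / 2 * R), f (u z) / u z ≤ K := fun z hz =>
    source_bound hn hfd hpos hΛ hmono hR hC hu' hupos heq hH hz
  have hsub : closedBall x (R / 4) ⊆ ball x₀ (3 / 2 * R) := by
    refine closedBall_subset_ball' ?_
    rw [mem_ball] at hx
    linarith
  have hsub2 : ball x₀ (3 / 2 * R) ⊆ ball x₀ (2 * R) := ball_subset_ball (by linarith)
  have hx' : x ∈ ball x₀ (3 / 2 * R) := hsub (mem_closedBall_self (by positivity))
  have hux := hupos x (hsub2 hx')
  have hgrad : ∀ i, |fderiv ℝ u x (EuclideanSpace.single i 1)|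
      ≤ (n * (C_H * u x / (R / 4) ^ 2) + K * (C_H * u x)) * (R / 4) :=
    abs_fderiv_single_le (by positivity) (by positivity) (by positivity)
      (fun z hz => hu' z (hsub2 (hsub hz)))
      (fun z hz => by
        rw [abs_of_pos (hupos z (hsub2 (hsub hz)))]
        exact hH z (hsub2 (hsub hz)) x (hsub2 hx'))
      (fun z hz => by
        have hz2 := hsub2 (hsub hz)
        have huz := hupos z hz2
        rw [show lap u z = -f (u z) by linarith [heq z hz2], abs_neg, abs_of_pos (hpos _ huz)]
        calc f (u z) ≤ K * u z := (div_le_iff₀ huz).1 (hsource z (hsub hz))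
          _ ≤ K * (C_H * u x) := by gcongr; exact hH z hz2 x (hsub2 hx'))
  have hCγ : 1 ≤ C_H ^ γ := Real.one_le_rpow hC (by linarith)
  have hgrad' : ∀ i, |fderiv ℝ u x (EuclideanSpace.single i 1)|
      ≤ (4 * n + a) * (C_H * C_H ^ γ) / R * u x := by
    intro i
    refine (hgrad i).trans ?_
    have : (n * (C_H * u x / (R / 4) ^ 2) + K * (C_H * u x)) * (R / 4)
        = (4 * n * (C_H * 1) + a / 4 * (C_H * C_H ^ γ)) / R * u x := by
      rw [hK]; field_simp
    rw [this, add_mul (4 * (n : ℝ))]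
    gcongr
    linarith
  have hpow : (C_H * C_H ^ γ) ^ 2 = C_H ^ (2 + 2 * γ) := by
    rw [← Real.rpow_one_add' hC0.le (by positivity), ← Real.rpow_natCast, ← Real.rpow_mul hC0.le]
    congr 1
    push_cast
    ring
  have h1 : ‖gradient u x‖ ^ 2 / u x ^ 2 ≤ n * (4 * n + a) ^ 2 * C_H ^ (2 + 2 * γ) / R ^ 2 := by
    rw [div_le_iff₀ (by positivity), norm_gradient_sq]
    calc ∑ i, (fderiv ℝ u x (EuclideanSpace.single i 1)) ^ 2
        ≤ ∑ _i : Fin n, ((4 * n + a) * (C_H * C_H ^ γ) / R * u x) ^ 2 :=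
          Finset.sum_le_sum fun i _ => sq_le_sq' (abs_le.1 (hgrad' i)).1 (abs_le.1 (hgrad' i)).2
      _ = n * (4 * n + a) ^ 2 * C_H ^ (2 + 2 * γ) / R ^ 2 * u x ^ 2 := by
          rw [← hpow]; simp; ring
  have h2 : f (u x) / u x ≤ a * C_H ^ (2 + 2 * γ) / R ^ 2 := by
    refine (hsource x hx').trans ?_
    rw [hK]
    gcongr
    linarith
  calc _ ≤ _ := add_le_add h1 h2
    _ = _ := by ring
end
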